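/- Let f ∈ 𝒟_w and μ̄ ∈ 𝒫_w be such that f(μ̄) = max_{𝒫_w} f. Let τ : ℝ^d → ℝ^{d×d} be C¹ and suppose that for every x ∈ E and every φ ∈ C_c^∞(ℝ^d) with φ(x) = max_E φ one has τ(x)^⊤ ∇φ(x) = 0. Define A_τ(φ) = Σ_{j=1}^d τ_j^⊤ ∇(τ_j^⊤ ∇φ) (τ_j the j-th column of τ), and ℵ_τ(φ ⊗ ψ)(x,y) = (τ(x)^⊤ ∇φ(x)) · (τ(y)^⊤ ∇ψ(y)), extended linearly to sums of tensor products. Assume A_τ maps C_w^∞ into L¹(ℝ^d, μ̄) and ℵ_τ maps C_w^∞ ⊗ C_w^∞ into L¹(ℝ^d × ℝ^d, μ̄ ⊗ μ̄). Then ⟨A_τ(∂f(μ̄)), μ̄⟩ + ⟨ℵ_τ(∂²f(μ̄)), μ̄²⟩ ≤ 0. -/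

import Mathlib

open MeasureTheory Filter Topology
open scoped NNReal ENNReal

noncomputable section

/-- The derivative `∂_x f(μ) = lim_{ε→0} (f(μ + ε δ_x) − f(μ))/ε` of a function of a
(nonnegative) measure argument, realized as the derivative at `0` from within `[0,∞)`
(which coincides with the two-sided derivative for the smooth functionals considered). -/
def mderiv {X : Type*} [MeasurableSpace X]
    (f : Measure X → ℝ) (μ : Measure X) (x : X) : ℝ :=
  derivWithin (fun ε : ℝ => f (μ + ENNReal.ofReal ε • Measure.dirac x)) (Set.Ici 0) 0

/-- The second derivative `∂²_{x,y} f(μ) = ∂_x(∂_y f)(μ)`. -/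
def mderiv2 {X : Type*} [MeasurableSpace X]
    (f : Measure X → ℝ) (μ : Measure X) (x y : X) : ℝ :=
  mderiv (fun ν => mderiv f ν y) μ x

/-- The generators `μ ↦ ⟨φ,μ⟩ e^{-⟨w,μ⟩}`, `φ ∈ C_c^∞(ℝ^d)`, of the algebra `𝒟_w`. -/
def DwGen {d : ℕ} (w : EuclideanSpace ℝ (Fin d) → ℝ) :
    Set (Measure (EuclideanSpace ℝ (Fin d)) → ℝ) :=
  {g | ∃ φ : EuclideanSpace ℝ (Fin d) → ℝ, ContDiff ℝ (⊤ : ℕ∞) φ ∧ HasCompactSupport φ ∧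
    g = fun μ => (∫ x, φ x ∂μ) * Real.exp (-(∫ x, w x ∂μ))}

/-- The space `C_w^∞`: the linear span of `w` and `C_c^∞(ℝ^d)`. -/
def CwInf {d : ℕ} (w : EuclideanSpace ℝ (Fin d) → ℝ) :
    Set (EuclideanSpace ℝ (Fin d) → ℝ) :=
  {φ | ∃ (c : ℝ) (ψ : EuclideanSpace ℝ (Fin d) → ℝ),
    ContDiff ℝ (⊤ : ℕ∞) ψ ∧ HasCompactSupport ψ ∧ φ = fun x => c * w x + ψ x}

/-- `A_τ(φ) = Σ_j τ_j^⊤ ∇(τ_j^⊤ ∇φ)`, where `τ_j` is the `j`-th column of `τ`. -/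
def Atau {d : ℕ} (τ : EuclideanSpace ℝ (Fin d) → Fin d → Fin d → ℝ)
    (φ : EuclideanSpace ℝ (Fin d) → ℝ) (x : EuclideanSpace ℝ (Fin d)) : ℝ :=
  ∑ j, ∑ i, τ x i j *
    gradient (fun y => ∑ k, τ y k j * gradient φ y k) x i

/-- `ℵ_τ`, on a function `ψ` of two variables:
`ℵ_τ(ψ)(x,y) = Σ_j Σ_{i,k} τ(x)_{ij} τ(y)_{kj} ∂_{x_i}∂_{y_k} ψ(x,y)`; on a tensor product
`ψ = φ₁ ⊗ φ₂` this is `(τ(x)^⊤∇φ₁(x)) ⬝ (τ(y)^⊤∇φ₂(y))`, extended linearly. -/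
def alephTau {d : ℕ} (τ : EuclideanSpace ℝ (Fin d) → Fin d → Fin d → ℝ)
    (ψ : EuclideanSpace ℝ (Fin d) → EuclideanSpace ℝ (Fin d) → ℝ)
    (x y : EuclideanSpace ℝ (Fin d)) : ℝ :=
  ∑ j, ∑ i, ∑ k, τ x i j * τ y k j *
    gradient (fun x' => gradient (fun y' => ψ x' y') y k) x i

section helpers

open Set

set_option linter.unusedSectionVars false

variable {X : Type*} [NormedAddCommGroup X] [InnerProductSpace ℝ X] [FiniteDimensional ℝ X]

def IsFlow (V : X → X) (φ : ℝ → X → X) : Prop :=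
  (∀ x, φ 0 x = x) ∧ ∀ x, ∀ t ∈ Ioo (-1 : ℝ) 1, HasDerivAt (fun s => φ s x) (V (φ t x)) t

lemma IsFlow.rev {V : X → X} {φ : ℝ → X → X} (h : IsFlow V φ) :
    IsFlow (fun x => - V x) (fun t x => φ (-t) x) := by
  refine ⟨fun x => by simpa using h.1 x, fun x t ht => ?_⟩
  have := (h.2 x (-t) ⟨by linarith [ht.2], by linarith [ht.1]⟩).scomp t (hasDerivAt_neg t)
  simpa [Function.comp_def] using this

lemma exists_flow {V : X → X} (hV : ContDiff ℝ 1 V) (hc : HasCompactSupport V) :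
    ∃ φ, IsFlow V φ := by
  obtain ⟨K, hK⟩ := ContDiff.lipschitzWith_of_hasCompactSupport hc hV one_ne_zero
  obtain ⟨C, hC⟩ := hc.exists_bound_of_continuous hV.continuous
  have key : ∀ x : X, ∃ α : ℝ → X, α 0 = x ∧ ∀ t ∈ Ioo (-1 : ℝ) 1,
      HasDerivAt α (V (α t)) t := by
    intro x
    have hP : IsPicardLindelof (fun _ : ℝ => V) (tmin := -1) (tmax := 1)
        ⟨0, by norm_num, by norm_num⟩ x C.toNNReal 0 C.toNNReal K := by
      apply IsPicardLindelof.of_time_independent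
      · intro y _
        exact (hC y).trans (Real.le_coe_toNNReal C)
      · exact hK.lipschitzOnWith
      · simp
    obtain ⟨α, h0, h1⟩ := hP.exists_eq_forall_mem_Icc_hasDerivWithinAt₀
    exact ⟨α, h0, fun t ht => (h1 t (Ioo_subset_Icc_self ht)).hasDerivAt (Icc_mem_nhds ht.1 ht.2)⟩
  choose α h0 h1 using key
  exact ⟨fun t x => α x t, h0, h1⟩

lemma IsFlow.continuous_fwd {V : X → X} {φ : ℝ → X → X} (h : IsFlow V φ) {K : ℝ≥0}
    (hK : LipschitzWith K V) {t : ℝ} (ht : t ∈ Ico (0 : ℝ) 1) : Continuous (φ t) := by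
  have : LipschitzWith (Real.exp (K * t)).toNNReal (φ t) := by
    apply LipschitzWith.of_dist_le_mul
    intro x y
    have hs : ∀ s ∈ Icc 0 t, s ∈ Ioo (-1 : ℝ) 1 := fun s hs =>
      ⟨by linarith [hs.1], by linarith [hs.2, ht.2]⟩
    have := dist_le_of_trajectories_ODE (v := fun _ => V) (f := fun s => φ s x)
      (g := fun s => φ s y) (a := 0) (b := t) (K := K) (δ := dist x y) (fun _ => hK)
      (fun s hs' => (h.2 x s (hs s hs')).continuousAt.continuousWithinAt)
      (fun s hs' => (h.2 x s (hs s (Ico_subset_Icc_self hs'))).hasDerivWithinAt)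
      (fun s hs' => (h.2 y s (hs s hs')).continuousAt.continuousWithinAt)
      (fun s hs' => (h.2 y s (hs s (Ico_subset_Icc_self hs'))).hasDerivWithinAt)
      (by simp [h.1]) t ⟨ht.1, le_rfl⟩
    rw [Real.coe_toNNReal _ (Real.exp_pos _).le, mul_comm]
    simpa using this
  exact this.continuous

lemma IsFlow.invariant_fwd {V : X → X} {φ : ℝ → X → X} (h : IsFlow V φ) {K : ℝ≥0}
    (hK : LipschitzWith K V) {E : Set X} (hE : IsClosed E)
    (hinv : ∀ x ∈ E, ∀ y, Metric.infDist y E = dist y x → inner ℝ (y - x) (V x) = 0)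
    {x : X} (hx : x ∈ E)
    {t : ℝ} (ht : t ∈ Ico (0 : ℝ) 1) : φ t x ∈ E := by
  have hne : E.Nonempty := ⟨x, hx⟩
  choose p hpE hp using fun y => hE.exists_infDist_eq_dist hne y
  have hs : ∀ s ∈ Icc 0 t, s ∈ Ioo (-1 : ℝ) 1 := fun s hs =>
      ⟨by linarith [hs.1], by linarith [hs.2, ht.2]⟩
  have hcont : ContinuousOn (fun s => (Metric.infDist (φ s x) E) ^ 2) (Icc 0 t) := by
    intro s hs'
    exact (((Metric.continuous_infDist_pt E).continuousAt.comp
      (h.2 x s (hs s hs')).continuousAt).pow 2).continuousWithinAt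
  have main := le_gronwallBound_of_liminf_deriv_right_le (a := 0) (b := t)
    (f := fun s => (Metric.infDist (φ s x) E) ^ 2)
    (f' := fun s => 2 * inner ℝ (φ s x - p (φ s x)) (V (φ s x)))
    (δ := 0) (K := 2 * K) (ε := 0) hcont ?_ ?_ ?_ t ⟨ht.1, le_rfl⟩
  · rw [gronwallBound_ε0_δ0] at main
    have h0 : Metric.infDist (φ t x) E = 0 := by
      have := sq_nonneg (Metric.infDist (φ t x) E)
      exact pow_eq_zero_iff (two_ne_zero) |>.1 (le_antisymm main this)
    exact (hE.mem_iff_infDist_zero hne).2 h0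
  · intro s hs' r hr
    have hd : HasDerivAt (fun z => ‖φ z x - p (φ s x)‖ ^ 2)
        (2 * inner ℝ (φ s x - p (φ s x)) (V (φ s x))) s :=
      ((h.2 x s (hs s (Ico_subset_Icc_self hs'))).sub_const _).norm_sq
    have hd' := (hd.hasDerivWithinAt (s := Ioi s))
    rw [hasDerivWithinAt_iff_tendsto_slope' (by simp)] at hd'
    have ev := hd'.eventually (gt_mem_nhds hr)
    apply Eventually.frequently
    filter_upwards [ev, self_mem_nhdsWithin] with z hz hzs
    refine lt_of_le_of_lt ?_ hz
    rw [slope_def_field, div_eq_inv_mul]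
    have hpos : 0 ≤ (z - s)⁻¹ := inv_nonneg.2 (sub_nonneg.2 (le_of_lt hzs))
    refine mul_le_mul_of_nonneg_left ?_ hpos
    have e1 : Metric.infDist (φ s x) E ^ 2 = ‖φ s x - p (φ s x)‖ ^ 2 := by
      rw [hp, dist_eq_norm]
    have e2 : Metric.infDist (φ z x) E ^ 2 ≤ ‖φ z x - p (φ s x)‖ ^ 2 := by
      rw [← dist_eq_norm]
      exact pow_le_pow_left₀ Metric.infDist_nonneg (Metric.infDist_le_dist_of_mem (hpE _)) 2
    linarith
  · simp [h.1, Metric.infDist_zero_of_mem hx]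
  · intro s hs'
    have h0 := hinv (p (φ s x)) (hpE _) (φ s x) (hp _)
    have e : inner ℝ (φ s x - p (φ s x)) (V (φ s x))
        = inner ℝ (φ s x - p (φ s x)) (V (φ s x) - V (p (φ s x))) := by
      rw [inner_sub_right, h0, sub_zero]
    have b : inner ℝ (φ s x - p (φ s x)) (V (φ s x) - V (p (φ s x)))
        ≤ K * Metric.infDist (φ s x) E ^ 2 := by
      refine (real_inner_le_norm _ _).trans ?_
      have := hK.dist_le_mul (φ s x) (p (φ s x))
      rw [dist_eq_norm, ← hp] at this
      rw [← dist_eq_norm (φ s x), ← hp]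
      nlinarith [Metric.infDist_nonneg (x := φ s x) (s := E)]
    rw [e]
    linarith

lemma IsFlow.continuous {V : X → X} {φ : ℝ → X → X} (h : IsFlow V φ) {K : ℝ≥0}
    (hK : LipschitzWith K V) {t : ℝ} (ht : t ∈ Ioo (-1 : ℝ) 1) : Continuous (φ t) := by
  rcases le_total 0 t with h0 | h0
  · exact h.continuous_fwd hK ⟨h0, ht.2⟩
  · have := h.rev.continuous_fwd (K := K) (t := -t) hK.neg ⟨by linarith, by linarith [ht.1]⟩
    simpa using this

lemma IsFlow.invariant {V : X → X} {φ : ℝ → X → X} (h : IsFlow V φ) {K : ℝ≥0}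
    (hK : LipschitzWith K V) {E : Set X} (hE : IsClosed E)
    (hinv : ∀ x ∈ E, ∀ y, Metric.infDist y E = dist y x → inner ℝ (y - x) (V x) = 0)
    {x : X} (hx : x ∈ E)
    {t : ℝ} (ht : t ∈ Ioo (-1 : ℝ) 1) : φ t x ∈ E := by
  rcases le_total 0 t with h0 | h0
  · exact h.invariant_fwd hK hE hinv hx ⟨h0, ht.2⟩
  · have := h.rev.invariant_fwd (K := K) (t := -t) hK.neg hE
      (fun x hx y hy => by rw [inner_neg_right, hinv x hx y hy, neg_zero]) hx
      ⟨by linarith, by linarith [ht.1]⟩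
    simpa using this

/-- the test function argument -/
lemma orth_of_test {E : Set X} {T : X → X}
    (hT : ∀ x ∈ E, ∀ φ : X → ℝ, ContDiff ℝ (⊤ : ℕ∞) φ → HasCompactSupport φ →
      (∀ y ∈ E, φ y ≤ φ x) → fderiv ℝ φ x (T x) = 0) :
    ∀ x ∈ E, ∀ y, Metric.infDist y E = dist y x → inner ℝ (y - x) (T x) = 0 := by
  intro x hx y hy
  set ρ : ℝ := dist y x + 1 with hρ
  have hd : 0 ≤ dist y x := dist_nonneg
  let β : ContDiffBump y := ⟨ρ, ρ + 1, by positivity, by linarith⟩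
  let φ : X → ℝ := fun z => β z * (ρ ^ 2 - ‖z - y‖ ^ 2)
  have h1 : ContDiff ℝ (⊤ : ℕ∞) φ :=
    β.contDiff.mul (contDiff_const.sub ((contDiff_id.sub contDiff_const).norm_sq ℝ))
  have h2 : HasCompactSupport φ := β.hasCompactSupport.mul_right
  have hxin : x ∈ Metric.ball y ρ := by
    rw [Metric.mem_ball, dist_comm]; linarith
  have hβx : β x = 1 := β.one_of_mem_closedBall (Metric.ball_subset_closedBall hxin)
  have h3 : ∀ z ∈ E, φ z ≤ φ x := by
    intro z hz
    have hdz : dist y x ≤ dist y z := hy ▸ Metric.infDist_le_dist_of_mem hz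
    have ex : φ x = ρ ^ 2 - dist y x ^ 2 := by
      simp only [φ, hβx, one_mul, dist_eq_norm, norm_sub_rev]
    have ez : φ z = β z * (ρ ^ 2 - dist y z ^ 2) := by
      simp only [φ, dist_eq_norm, norm_sub_rev]
    rw [ex, ez]
    rcases le_total (dist y z) ρ with hle | hle
    · rw [β.one_of_mem_closedBall (by rw [Metric.mem_closedBall, dist_comm]; exact hle)]
      nlinarith
    · have : ρ ^ 2 - dist y z ^ 2 ≤ 0 := by nlinarith
      have := mul_nonpos_of_nonneg_of_nonpos (β.nonneg (x := z)) this
      nlinarith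
  have h4 := hT x hx φ h1 h2 h3
  have heq : φ =ᶠ[𝓝 x] fun z => ρ ^ 2 - ‖z - y‖ ^ 2 := by
    filter_upwards [Metric.isOpen_ball.mem_nhds hxin] with z hz
    simp [φ, β.one_of_mem_closedBall (Metric.ball_subset_closedBall hz)]
  rw [heq.fderiv_eq] at h4
  have hder : HasFDerivAt (fun z : X => ρ ^ 2 - ‖z - y‖ ^ 2)
      (-(2 • (innerSL ℝ (x - y)).comp (ContinuousLinearMap.id ℝ X))) x :=
    (((hasFDerivAt_id x).sub_const y).norm_sq).const_sub _
  rw [hder.fderiv] at h4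
  simp at h4
  rw [inner_sub_left]
  linarith

variable [MeasurableSpace X] [BorelSpace X]
  {W : Type*} [NormedAddCommGroup W] [NormedSpace ℝ W] [FiniteDimensional ℝ W]

lemma two_le_top : (1 : WithTop ℕ∞) + 1 ≤ ((⊤ : ℕ∞) : WithTop ℕ∞) := by
  have : ((2 : ℕ∞) : WithTop ℕ∞) ≤ ((⊤ : ℕ∞) : WithTop ℕ∞) := WithTop.coe_le_coe.2 le_top
  refine le_trans (le_of_eq ?_) this
  exact one_add_one_eq_two

lemma IsFlow.integral_deriv {V : X → X} {φ : ℝ → X → X} (h : IsFlow V φ)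
    (hV : ContDiff ℝ 1 V) (hc : HasCompactSupport V) (μ : Measure X) [IsFiniteMeasure μ]
    {G : X → W} (hG : ContDiff ℝ 1 G) (hGi : Integrable G μ) {t : ℝ} (ht : t ∈ Ioo (-1 : ℝ) 1) :
    Integrable (fun x => G (φ t x)) μ ∧
    HasDerivAt (fun s => ∫ x, G (φ s x) ∂μ) (∫ x, fderiv ℝ G (φ t x) (V (φ t x)) ∂μ) t := by
  obtain ⟨K, hK⟩ := ContDiff.lipschitzWith_of_hasCompactSupport hc hV one_ne_zero
  have hcont : Continuous (fun x => fderiv ℝ G x (V x)) :=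
    (hG.continuous_fderiv one_ne_zero).clm_apply hV.continuous
  have hcs : HasCompactSupport (fun x => fderiv ℝ G x (V x)) := by
    apply hc.mono
    intro x hx hx0
    apply hx
    simp [hx0]
  obtain ⟨C, hC⟩ := hcs.exists_bound_of_continuous hcont
  have hder : ∀ x, ∀ s ∈ Ioo (-1 : ℝ) 1,
      HasDerivAt (fun s => G (φ s x)) (fderiv ℝ G (φ s x) (V (φ s x))) s := fun x s hs =>
    ((hG.differentiable one_ne_zero) (φ s x)).hasFDerivAt.comp_hasDerivAt s (h.2 x s hs)
  have hint : Integrable (fun x => G (φ t x)) μ := by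
    have hb : Integrable (fun x => G (φ t x) - G x) μ := by
      refine Integrable.of_bound (C := C * ‖t - 0‖) ?_ ?_
      · exact ((hG.continuous.comp (h.continuous hK ht)).sub hG.continuous).aestronglyMeasurable
      · refine ae_of_all _ fun x => ?_
        have := Convex.norm_image_sub_le_of_norm_hasDerivWithin_le (s := Ioo (-1 : ℝ) 1)
          (f := fun s => G (φ s x)) (f' := fun s => fderiv ℝ G (φ s x) (V (φ s x))) (C := C)
          (fun s hs => (hder x s hs).hasDerivWithinAt) (fun s hs => hC _) (convex_Ioo _ _)
          (x := 0) (y := t) (by norm_num) ht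
        simpa [h.1] using this
    have := hb.add hGi
    refine this.congr (ae_of_all _ fun x => ?_)
    simp
  refine ⟨hint, ?_⟩
  refine (hasDerivAt_integral_of_dominated_loc_of_deriv_le (s := Ioo (-1 : ℝ) 1)
    (F := fun s x => G (φ s x)) (F' := fun s x => fderiv ℝ G (φ s x) (V (φ s x)))
    (bound := fun _ => C) (Ioo_mem_nhds ht.1 ht.2) ?_ hint ?_ ?_ (integrable_const _) ?_).2
  · filter_upwards [Ioo_mem_nhds ht.1 ht.2] with s hs
    exact (hG.continuous.comp (h.continuous hK hs)).aestronglyMeasurable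
  · exact (hcont.comp (h.continuous hK ht)).aestronglyMeasurable
  · exact ae_of_all _ fun x s _ => hC _
  · exact ae_of_all _ fun x s hs => hder x s hs

lemma second_deriv_test {h h' : ℝ → ℝ} {h'' : ℝ}
    (h1 : ∀ t ∈ Ioo (-1 : ℝ) 1, HasDerivAt h (h' t) t) (h2 : HasDerivAt h' h'' 0)
    (hm : ∀ t ∈ Ioo (-1 : ℝ) 1, h t ≤ h 0) : h' 0 = 0 ∧ h'' ≤ 0 := by
  have hmem : Ioo (-1 : ℝ) 1 ∈ 𝓝 (0 : ℝ) := Ioo_mem_nhds (by norm_num) (by norm_num)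
  have hmax : IsLocalMax h 0 := by
    filter_upwards [hmem] with t ht using hm t ht
  have h0 := h1 0 (by norm_num)
  have hz := hmax.hasDerivAt_eq_zero h0
  refine ⟨hz, ?_⟩
  by_contra! hpos
  have hde : deriv h =ᶠ[𝓝 0] h' := by
    filter_upwards [hmem] with t ht using (h1 t ht).deriv
  have hdd : deriv (deriv h) 0 = h'' := by rw [hde.deriv_eq, h2.deriv]
  have hmin := isLocalMin_of_deriv_deriv_pos (f := h) (x₀ := 0) (by rw [hdd]; exact hpos)
    (by rw [h0.deriv, hz]) h0.continuousAt
  have hconst : h =ᶠ[𝓝 0] fun _ => h 0 := by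
    filter_upwards [hmin, hmax] with t a b using le_antisymm b a
  have : deriv h =ᶠ[𝓝 0] deriv (fun _ => h 0) := hconst.deriv
  have h3 : deriv (deriv h) 0 = 0 := by rw [this.deriv_eq]; simp
  linarith

lemma second_order {V : X → X} {E : Set X} (hE : IsClosed E)
    (hinv : ∀ x ∈ E, ∀ y, Metric.infDist y E = dist y x → inner ℝ (y - x) (V x) = 0)
    (hV : ContDiff ℝ 1 V) (hc : HasCompactSupport V)
    (μ : Measure X) [IsProbabilityMeasure μ] (hμE : μ Eᶜ = 0)
    {w : X → ℝ} (hw : ContDiff ℝ (⊤ : ℕ∞) w) (hwi : Integrable w μ)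
    {Φ : X → W} (hΦ : ContDiff ℝ (⊤ : ℕ∞) Φ) (hΦi : Integrable Φ μ)
    {F : W → ℝ} (hF : ContDiff ℝ (⊤ : ℕ∞) F)
    (hmax : ∀ ν : Measure X, IsProbabilityMeasure ν → Integrable w ν → ν Eᶜ = 0 →
      F (∫ x, Φ x ∂ν) ≤ F (∫ x, Φ x ∂μ)) :
    fderiv ℝ F (∫ x, Φ x ∂μ) (∫ x, fderiv ℝ Φ x (V x) ∂μ) = 0 ∧
    fderiv ℝ (fderiv ℝ F) (∫ x, Φ x ∂μ) (∫ x, fderiv ℝ Φ x (V x) ∂μ)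
        (∫ x, fderiv ℝ Φ x (V x) ∂μ)
      + fderiv ℝ F (∫ x, Φ x ∂μ)
        (∫ x, fderiv ℝ (fun y => fderiv ℝ Φ y (V y)) x (V x) ∂μ) ≤ 0 := by
  obtain ⟨φ, h⟩ := exists_flow hV hc
  obtain ⟨K, hK⟩ := ContDiff.lipschitzWith_of_hasCompactSupport hc hV one_ne_zero
  have hv1 : ContDiff ℝ 1 (fun x => fderiv ℝ Φ x (V x)) :=
    (hΦ.fderiv_right (m := 1) two_le_top).clm_apply hV
  have hcs : HasCompactSupport (fun x => fderiv ℝ Φ x (V x)) := by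
    apply hc.mono
    intro x hx hx0
    apply hx
    simp [hx0]
  have hvi : Integrable (fun x => fderiv ℝ Φ x (V x)) μ :=
    hv1.continuous.integrable_of_hasCompactSupport hcs
  have d1 := fun t ht => (h.integral_deriv hV hc μ (hΦ.of_le (by exact_mod_cast le_top)) hΦi (t := t) ht).2
  have d2 := (h.integral_deriv hV hc μ hv1 hvi (t := 0) (by norm_num)).2
  have hF1 : ∀ z, HasFDerivAt F (fderiv ℝ F z) z := fun z =>
    (hF.differentiable (by simp) z).hasFDerivAt
  have hF2 : ∀ z, HasFDerivAt (fderiv ℝ F) (fderiv ℝ (fderiv ℝ F) z) z := fun z =>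
    ((hF.fderiv_right (m := 1) two_le_top).differentiable one_ne_zero z).hasFDerivAt
  have e1 : ∀ t ∈ Ioo (-1 : ℝ) 1, HasDerivAt (fun s => F (∫ x, Φ (φ s x) ∂μ))
      (fderiv ℝ F (∫ x, Φ (φ t x) ∂μ) (∫ x, fderiv ℝ Φ (φ t x) (V (φ t x)) ∂μ)) t :=
    fun t ht => (hF1 _).comp_hasDerivAt t (d1 t ht)
  have e2a : HasDerivAt (fun t => fderiv ℝ F (∫ x, Φ (φ t x) ∂μ))
      (fderiv ℝ (fderiv ℝ F) (∫ x, Φ (φ 0 x) ∂μ) (∫ x, fderiv ℝ Φ (φ 0 x) (V (φ 0 x)) ∂μ)) 0 :=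
    HasFDerivAt.comp_hasDerivAt (f := fun t => ∫ x, Φ (φ t x) ∂μ) 0 (hF2 _) (d1 0 (by norm_num))
  have e2 : HasDerivAt (fun t => fderiv ℝ F (∫ x, Φ (φ t x) ∂μ)
      (∫ x, fderiv ℝ Φ (φ t x) (V (φ t x)) ∂μ))
      (fderiv ℝ (fderiv ℝ F) (∫ x, Φ (φ 0 x) ∂μ) (∫ x, fderiv ℝ Φ (φ 0 x) (V (φ 0 x)) ∂μ)
        (∫ x, fderiv ℝ Φ (φ 0 x) (V (φ 0 x)) ∂μ) +
      fderiv ℝ F (∫ x, Φ (φ 0 x) ∂μ)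
        (∫ x, fderiv ℝ (fun y => fderiv ℝ Φ y (V y)) (φ 0 x) (V (φ 0 x)) ∂μ)) 0 :=
    HasDerivAt.clm_apply e2a d2
  have key := second_deriv_test e1 e2 ?_
  · simp only [h.1] at key
    exact key
  · intro t ht
    have hm : Measurable (φ t) := (h.continuous hK ht).measurable
    have := hmax (μ.map (φ t)) (Measure.isProbabilityMeasure_map hm.aemeasurable) ?_ ?_
    · rw [integral_map hm.aemeasurable hΦ.continuous.aestronglyMeasurable] at this
      simpa [h.1] using this
    · rw [integrable_map_measure hw.continuous.aestronglyMeasurable hm.aemeasurable]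
      exact (h.integral_deriv hV hc μ (hw.of_le (by exact_mod_cast le_top)) hwi ht).1
    · rw [Measure.map_apply hm hE.isOpen_compl.measurableSet]
      refine measure_mono_null ?_ hμE
      intro x hx hxE
      exact hx (h.invariant hK hE hinv hxE ht)

lemma core {ι : Type*} [Fintype ι] {T : ι → X → X} {E : Set X} (hE : IsClosed E)
    (hinv : ∀ j, ∀ x ∈ E, ∀ y, Metric.infDist y E = dist y x → inner ℝ (y - x) (T j x) = 0)
    (hT : ∀ j, ContDiff ℝ 1 (T j))
    (μ : Measure X) [IsProbabilityMeasure μ] (hμE : μ Eᶜ = 0)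
    {w : X → ℝ} (hw : ContDiff ℝ (⊤ : ℕ∞) w) (hwi : Integrable w μ)
    {Φ : X → W} (hΦ : ContDiff ℝ (⊤ : ℕ∞) Φ) (hΦi : Integrable Φ μ)
    {F : W → ℝ} (hF : ContDiff ℝ (⊤ : ℕ∞) F)
    (hmax : ∀ ν : Measure X, IsProbabilityMeasure ν → Integrable w ν → ν Eᶜ = 0 →
      F (∫ x, Φ x ∂ν) ≤ F (∫ x, Φ x ∂μ))
    (l : W →L[ℝ] ℝ) (hl : l = fderiv ℝ F (∫ x, Φ x ∂μ))
    (B : W →L[ℝ] W →L[ℝ] ℝ) (hB : B = fderiv ℝ (fderiv ℝ F) (∫ x, Φ x ∂μ))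
    (hi1 : Integrable (fun x => ∑ j, l (fderiv ℝ (fun y => fderiv ℝ Φ y (T j y)) x (T j x))) μ)
    (hi2 : Integrable (fun p : X × X =>
      ∑ j, B (fderiv ℝ Φ p.1 (T j p.1)) (fderiv ℝ Φ p.2 (T j p.2))) (μ.prod μ)) :
    ∫ x, ∑ j, l (fderiv ℝ (fun y => fderiv ℝ Φ y (T j y)) x (T j x)) ∂μ +
    ∫ p : X × X, ∑ j, B (fderiv ℝ Φ p.1 (T j p.1)) (fderiv ℝ Φ p.2 (T j p.2)) ∂(μ.prod μ) ≤ 0 := by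
  have hv1 : ∀ j, ContDiff ℝ 1 (fun x => fderiv ℝ Φ x (T j x)) := fun j =>
    (hΦ.fderiv_right (m := 1) two_le_top).clm_apply (hT j)
  have hso : ∀ j, ∀ χ : X → ℝ, ContDiff ℝ 1 χ → HasCompactSupport χ → _ := fun j χ h1 h2 =>
    second_order (V := fun x => χ x • T j x) hE
      (fun x hx y hy => by rw [inner_smul_right, hinv j x hx y hy, mul_zero])
      (h1.smul (hT j)) (h2.smul_right) μ hμE hw hwi hΦ hΦi hF hmax
  simp only [← hl, ← hB, map_smul] at hso
  -- truncated inequality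
  have trunc : ∀ χ : X → ℝ, ContDiff ℝ (⊤ : ℕ∞) χ → HasCompactSupport χ →
      ∫ x, χ x ^ 2 * ∑ j, l (fderiv ℝ (fun y => fderiv ℝ Φ y (T j y)) x (T j x)) ∂μ +
      ∫ p : X × X, χ p.1 * χ p.2 *
        ∑ j, B (fderiv ℝ Φ p.1 (T j p.1)) (fderiv ℝ Φ p.2 (T j p.2)) ∂(μ.prod μ) ≤ 0 := by
    intro χ hχ hχc
    have hχ1 : ContDiff ℝ 1 χ := hχ.of_le (by exact_mod_cast le_top)
    have hcA : ∀ j, Continuous (fun x => χ x ^ 2 •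
        (fderiv ℝ (fun y => fderiv ℝ Φ y (T j y)) x (T j x))) := fun j =>
      (hχ.continuous.pow 2).smul (((hv1 j).continuous_fderiv one_ne_zero).clm_apply
        (hT j).continuous)
    have hχ2c : HasCompactSupport (fun x => χ x ^ 2) := by
      refine hχc.mono fun x hx hx0 => hx ?_
      simp [hx0]
    have hiA : ∀ j, Integrable (fun x => χ x ^ 2 •
        (fderiv ℝ (fun y => fderiv ℝ Φ y (T j y)) x (T j x))) μ := fun j =>
      (hcA j).integrable_of_hasCompactSupport hχ2c.smul_right
    have hχ' : ∀ j, ContDiff ℝ 1 (fun x => χ x * fderiv ℝ χ x (T j x)) := fun j =>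
      hχ1.mul ((hχ.fderiv_right (m := 1) two_le_top).clm_apply (hT j))
    have hiR : ∀ j, Integrable (fun x => (χ x * fderiv ℝ χ x (T j x)) •
        fderiv ℝ Φ x (T j x)) μ := fun j =>
      ((hχ' j).continuous.smul (hv1 j).continuous).integrable_of_hasCompactSupport
        (hχc.mul_right.smul_right)
    have hiv : ∀ j, Integrable (fun x => χ x • fderiv ℝ Φ x (T j x)) μ := fun j =>
      (hχ.continuous.smul (hv1 j).continuous).integrable_of_hasCompactSupport hχc.smul_right
    have hi3 : ∀ j, Integrable (fun p : X × X => χ p.1 * χ p.2 *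
        B (fderiv ℝ Φ p.1 (T j p.1)) (fderiv ℝ Φ p.2 (T j p.2))) (μ.prod μ) := by
      intro j
      have hcv : Continuous (fun x => χ x • fderiv ℝ Φ x (T j x)) :=
        hχ.continuous.smul (hv1 j).continuous
      obtain ⟨C, hC⟩ := (hχc.smul_right (f' := fun x => fderiv ℝ Φ x (T j x))).exists_bound_of_continuous hcv
      have hC0 : 0 ≤ C := (norm_nonneg _).trans (hC 0)
      have : Integrable (fun p : X × X => B (χ p.1 • fderiv ℝ Φ p.1 (T j p.1))
          (χ p.2 • fderiv ℝ Φ p.2 (T j p.2))) (μ.prod μ) := by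
        refine Integrable.of_bound (C := ‖B‖ * C * C) ?_ (ae_of_all _ fun p => ?_)
        · exact ((B.continuous.comp (hcv.comp continuous_fst)).clm_apply
            (hcv.comp continuous_snd)).aestronglyMeasurable
        · refine (B.le_opNorm₂ _ _).trans ?_
          gcongr
          · exact hC _
          · exact hC _
      refine this.congr (ae_of_all _ fun p => ?_)
      simp only [map_smul, smul_apply, smul_eq_mul]
      ring
    have hj : ∀ j, ∫ x, χ x ^ 2 * l (fderiv ℝ (fun y => fderiv ℝ Φ y (T j y)) x (T j x)) ∂μ +
      ∫ p : X × X, χ p.1 * χ p.2 *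
        B (fderiv ℝ Φ p.1 (T j p.1)) (fderiv ℝ Φ p.2 (T j p.2)) ∂(μ.prod μ) ≤ 0 := by
      intro j
      have s1 := (hso j _ (hχ' j) hχc.mul_right).1
      have s2 := (hso j χ hχ1 hχc).2
      have eD : ∀ x, χ x • fderiv ℝ (fun y => χ y • fderiv ℝ Φ y (T j y)) x (T j x) =
          χ x ^ 2 • (fderiv ℝ (fun y => fderiv ℝ Φ y (T j y)) x (T j x)) +
          (χ x * fderiv ℝ χ x (T j x)) • fderiv ℝ Φ x (T j x) := by
        intro x
        rw [fderiv_fun_smul (hχ1.differentiable one_ne_zero x)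
          ((hv1 j).differentiable one_ne_zero x)]
        simp [smul_smul, pow_two]
      simp only [eD] at s2
      rw [integral_add (hiA j) (hiR j), map_add, s1, add_zero] at s2
      have i1 : l (∫ x, χ x ^ 2 • (fderiv ℝ (fun y => fderiv ℝ Φ y (T j y)) x (T j x)) ∂μ) =
          ∫ x, χ x ^ 2 * l (fderiv ℝ (fun y => fderiv ℝ Φ y (T j y)) x (T j x)) ∂μ := by
        rw [← l.integral_comp_comm (hiA j)]
        simp
      have i2 : B (∫ x, χ x • fderiv ℝ Φ x (T j x) ∂μ) (∫ x, χ x • fderiv ℝ Φ x (T j x) ∂μ) =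
          ∫ p : X × X, χ p.1 * χ p.2 *
            B (fderiv ℝ Φ p.1 (T j p.1)) (fderiv ℝ Φ p.2 (T j p.2)) ∂(μ.prod μ) := by
        rw [integral_prod _ (hi3 j)]
        set c := ∫ x, χ x • fderiv ℝ Φ x (T j x) ∂μ with hcdef
        have a1 : ∀ x, ∫ y, χ x * χ y * B (fderiv ℝ Φ x (T j x)) (fderiv ℝ Φ y (T j y)) ∂μ =
            B.flip c (χ x • fderiv ℝ Φ x (T j x)) := by
          intro x
          rw [ContinuousLinearMap.flip_apply, hcdef,
            ← (B (χ x • fderiv ℝ Φ x (T j x))).integral_comp_comm (hiv j)]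
          congr 1
          ext y
          simp only [map_smul, smul_apply, smul_eq_mul]
          ring
        simp only [a1]
        rw [(B.flip c).integral_comp_comm (hiv j), ← hcdef, ContinuousLinearMap.flip_apply]
      linarith
    have fin := Finset.sum_nonpos (s := Finset.univ) (fun j _ => hj j)
    rw [Finset.sum_add_distrib] at fin
    rw [← integral_finsetSum, ← integral_finsetSum] at fin
    · simpa only [Finset.mul_sum] using fin
    · intro j _
      exact hi3 j
    · intro j _
      simpa using l.integrable_comp (hiA j)
  -- limit
  let β : ℕ → ContDiffBump (0 : X) := fun n => ⟨n + 1, n + 2, by positivity, by linarith⟩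
  have hlim : ∀ x, Tendsto (fun n => β n x) atTop (𝓝 1) := by
    intro x
    apply tendsto_const_nhds.congr'
    obtain ⟨N, hN⟩ := exists_nat_ge ‖x‖
    filter_upwards [eventually_ge_atTop N] with n hn
    symm
    apply (β n).one_of_mem_closedBall
    have : (N : ℝ) ≤ n := by exact_mod_cast hn
    simp only [mem_closedBall_zero_iff, β]
    linarith
  have t1 := tendsto_integral_of_dominated_convergence (μ := μ)
    (F := fun n x => β n x ^ 2 * ∑ j, l (fderiv ℝ (fun y => fderiv ℝ Φ y (T j y)) x (T j x)))
    (f := fun x => ∑ j, l (fderiv ℝ (fun y => fderiv ℝ Φ y (T j y)) x (T j x)))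
    _ (fun n => (((β n).continuous.pow 2).aestronglyMeasurable.mul hi1.1)) hi1.norm
    (fun n => ae_of_all _ fun x => by
      rw [norm_mul]
      refine mul_le_of_le_one_left (norm_nonneg _) ?_
      rw [Real.norm_of_nonneg (by positivity)]
      exact pow_le_one₀ (β n).nonneg (β n).le_one)
    (ae_of_all _ fun x => by simpa using ((hlim x).pow 2).mul_const _)
  have t2 := tendsto_integral_of_dominated_convergence (μ := μ.prod μ)
    (F := fun n p => β n p.1 * β n p.2 *
      ∑ j, B (fderiv ℝ Φ p.1 (T j p.1)) (fderiv ℝ Φ p.2 (T j p.2)))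
    (f := fun p => ∑ j, B (fderiv ℝ Φ p.1 (T j p.1)) (fderiv ℝ Φ p.2 (T j p.2)))
    _ (fun n => ((((β n).continuous.comp continuous_fst).mul
      ((β n).continuous.comp continuous_snd)).aestronglyMeasurable.mul hi2.1)) hi2.norm
    (fun n => ae_of_all _ fun x => by
      rw [norm_mul]
      refine mul_le_of_le_one_left (norm_nonneg _) ?_
      rw [Real.norm_of_nonneg (mul_nonneg (β n).nonneg (β n).nonneg)]
      exact mul_le_one₀ (β n).le_one (β n).nonneg (β n).le_one)
    (ae_of_all _ fun x => by simpa using ((hlim x.1).mul (hlim x.2)).mul_const _)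
  exact le_of_tendsto (t1.add t2)
    (Eventually.of_forall fun n => trunc _ (β n).contDiff (β n).hasCompactSupport)

end helpers

section helpers2

variable {d : ℕ}

def MRep (w : EuclideanSpace ℝ (Fin d) → ℝ) (f : Measure (EuclideanSpace ℝ (Fin d)) → ℝ) : Prop :=
  ∃ (W : Type) (_ : NormedAddCommGroup W) (_ : NormedSpace ℝ W) (_ : FiniteDimensional ℝ W)
    (a : W) (ψ : EuclideanSpace ℝ (Fin d) → W) (F : W → ℝ),
    ContDiff ℝ (⊤ : ℕ∞) ψ ∧ HasCompactSupport ψ ∧ ContDiff ℝ (⊤ : ℕ∞) F ∧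
    ∀ μ : Measure (EuclideanSpace ℝ (Fin d)), IsFiniteMeasure μ → Integrable w μ →
      f μ = F (∫ x, (w x • a + ψ x) ∂μ)

lemma integrable_rep {W : Type} [NormedAddCommGroup W] [NormedSpace ℝ W] [FiniteDimensional ℝ W]
    {w : EuclideanSpace ℝ (Fin d) → ℝ} {a : W} {ψ : EuclideanSpace ℝ (Fin d) → W}
    (hψ : ContDiff ℝ (⊤ : ℕ∞) ψ) (hc : HasCompactSupport ψ)
    {μ : Measure (EuclideanSpace ℝ (Fin d))} [IsFiniteMeasure μ] (hw : Integrable w μ) :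
    Integrable (fun x => w x • a + ψ x) μ :=
  (hw.smul_const a).add (hψ.continuous.integrable_of_hasCompactSupport hc)

lemma hcs_prod {X V W : Type*} [TopologicalSpace X] [R1Space X] [Zero V] [Zero W]
    {f : X → V} {g : X → W}
    (hf : HasCompactSupport f) (hg : HasCompactSupport g) :
    HasCompactSupport (fun x => (f x, g x)) := by
  refine HasCompactSupport.intro (hf.isCompact.union hg.isCompact) fun x hx => ?_
  rw [Set.mem_union, not_or] at hx
  simp [image_eq_zero_of_notMem_tsupport hx.1, image_eq_zero_of_notMem_tsupport hx.2]

lemma MRep.op {w : EuclideanSpace ℝ (Fin d) → ℝ} {f g : Measure (EuclideanSpace ℝ (Fin d)) → ℝ}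
    (hf : MRep w f) (hg : MRep w g) (op : ℝ → ℝ → ℝ)
    (hop : ContDiff ℝ (⊤ : ℕ∞) (fun p : ℝ × ℝ => op p.1 p.2)) :
    MRep w (fun μ => op (f μ) (g μ)) := by
  obtain ⟨W₁, i1, i2, i3, a₁, ψ₁, F₁, h1, h2, h3, h4⟩ := hf
  obtain ⟨W₂, j1, j2, j3, a₂, ψ₂, F₂, k1, k2, k3, k4⟩ := hg
  refine ⟨W₁ × W₂, inferInstance, inferInstance, inferInstance, (a₁, a₂),
    fun x => (ψ₁ x, ψ₂ x), fun p => op (F₁ p.1) (F₂ p.2), h1.prodMk k1, hcs_prod h2 k2,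
    hop.comp ((h3.comp contDiff_fst).prodMk (k3.comp contDiff_snd)), ?_⟩
  intro μ hμ hwi
  beta_reduce
  rw [h4 μ hμ hwi, k4 μ hμ hwi]
  have := integral_pair (integrable_rep h1 h2 (a := a₁) hwi) (integrable_rep k1 k2 (a := a₂) hwi)
  simp only [Prod.smul_mk, Prod.mk_add_mk]
  rw [this]

lemma rep_of_mem {w : EuclideanSpace ℝ (Fin d) → ℝ} {f : Measure (EuclideanSpace ℝ (Fin d)) → ℝ}
    (hf : f ∈ NonUnitalAlgebra.adjoin ℝ (DwGen w)) : MRep w f := by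
  induction hf using NonUnitalAlgebra.adjoin_induction with
  | mem g hg =>
    obtain ⟨φ, h1, h2, rfl⟩ := hg
    refine ⟨ℝ × ℝ, inferInstance, inferInstance, inferInstance, (0, 1),
      fun x => (φ x, 0), fun p => p.1 * Real.exp (- p.2), h1.prodMk contDiff_const,
      hcs_prod h2 HasCompactSupport.zero,
      contDiff_fst.mul (Real.contDiff_exp.comp contDiff_snd.neg), ?_⟩
    intro μ hμ hwi
    have := integral_pair (h1.continuous.integrable_of_hasCompactSupport h2 (μ := μ)) hwi
    simp only [Prod.smul_mk, Prod.mk_add_mk, smul_eq_mul, mul_zero, mul_one, zero_add, add_zero]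
    rw [this]
  | add f g _ _ h1 h2 => exact h1.op h2 (fun a b => a + b) (contDiff_fst.add contDiff_snd)
  | mul f g _ _ h1 h2 => exact h1.op h2 (fun a b => a * b) (contDiff_fst.mul contDiff_snd)
  | zero =>
    exact ⟨ℝ, inferInstance, inferInstance, inferInstance, 0, fun _ => 0, fun _ => 0,
      contDiff_const, HasCompactSupport.zero, contDiff_const, fun _ _ _ => rfl⟩
  | smul r f _ h => exact h.op h (fun a _ => r * a) (contDiff_const.mul contDiff_fst)

lemma sum_gradient (φ : EuclideanSpace ℝ (Fin d) → ℝ) (x : EuclideanSpace ℝ (Fin d))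
    (v : Fin d → ℝ) :
    ∑ i, v i * gradient φ x i = fderiv ℝ φ x (WithLp.toLp 2 v) := by
  rw [← inner_gradient_left, PiLp.inner_apply]
  simp

lemma gradient_apply (φ : EuclideanSpace ℝ (Fin d) → ℝ) (x : EuclideanSpace ℝ (Fin d))
    (k : Fin d) :
    gradient φ x k = fderiv ℝ φ x (EuclideanSpace.single k 1) := by
  rw [← inner_gradient_left, EuclideanSpace.inner_single_right]
  simp

lemma fderiv_clm_comp' {Y W : Type*} [NormedAddCommGroup Y] [NormedSpace ℝ Y]
    [NormedAddCommGroup W] [NormedSpace ℝ W]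
    (l : W →L[ℝ] ℝ) {G : Y → W} {y : Y} (hG : DifferentiableAt ℝ G y) (v : Y) :
    fderiv ℝ (fun z => l (G z)) y v = l (fderiv ℝ G y v) := by
  have : HasFDerivAt (fun z => l (G z)) (l.comp (fderiv ℝ G y)) y :=
    l.hasFDerivAt.comp y hG.hasFDerivAt
  rw [this.fderiv]
  rfl

lemma mderiv_rep {W : Type} [NormedAddCommGroup W] [NormedSpace ℝ W] [FiniteDimensional ℝ W]
    {w : EuclideanSpace ℝ (Fin d) → ℝ} {Φ : EuclideanSpace ℝ (Fin d) → W} 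
    {G : W → ℝ} {f : Measure (EuclideanSpace ℝ (Fin d)) → ℝ}
    (hΦi : ∀ μ : Measure (EuclideanSpace ℝ (Fin d)), IsFiniteMeasure μ → Integrable w μ →
      Integrable Φ μ)
    (hf : ∀ μ : Measure (EuclideanSpace ℝ (Fin d)), IsFiniteMeasure μ → Integrable w μ →
      f μ = G (∫ x, Φ x ∂μ)) (hG : Differentiable ℝ G)
    (μ : Measure (EuclideanSpace ℝ (Fin d))) [IsFiniteMeasure μ] (hwi : Integrable w μ)
    (x : EuclideanSpace ℝ (Fin d)) :
    mderiv f μ x = fderiv ℝ G (∫ x, Φ x ∂μ) (Φ x) := by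
  have key : ∀ ε ∈ Set.Ici (0 : ℝ), f (μ + ENNReal.ofReal ε • Measure.dirac x) =
      G ((∫ x, Φ x ∂μ) + ε • Φ x) := by
    intro ε hε
    have hfin : IsFiniteMeasure (ENNReal.ofReal ε • Measure.dirac x) :=
      Measure.smul_finite _ ENNReal.ofReal_ne_top
    have hwd : Integrable w (ENNReal.ofReal ε • Measure.dirac x) :=
      (integrable_dirac (by simp)).smul_measure ENNReal.ofReal_ne_top
    rw [hf _ inferInstance (hwi.add_measure hwd), integral_add_measure (hΦi μ inferInstance hwi)
      (hΦi _ hfin hwd), integral_smul_measure, integral_dirac, ENNReal.toReal_ofReal hε]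
  unfold mderiv
  rw [derivWithin_congr key (key 0 (by simp))]
  have h1 : HasDerivAt (fun ε : ℝ => (∫ x, Φ x ∂μ) + ε • Φ x) (Φ x) 0 := by
    simpa using ((hasDerivAt_id (0 : ℝ)).smul_const (Φ x)).const_add (∫ x, Φ x ∂μ)
  have h2 : HasDerivAt (fun ε : ℝ => G ((∫ x, Φ x ∂μ) + ε • Φ x))
      (fderiv ℝ G (∫ x, Φ x ∂μ) (Φ x)) 0 := by
    have := HasFDerivAt.comp_hasDerivAt (f := fun ε : ℝ => (∫ x, Φ x ∂μ) + ε • Φ x) 0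
      (hG _).hasFDerivAt h1
    simpa [Function.comp_def] using this
  exact h2.hasDerivWithinAt.derivWithin (uniqueDiffOn_Ici 0 0 (by simp))

end helpers2

/-- Let `f ∈ 𝒟_w` and `μ̄ ∈ 𝒫_w` with `f(μ̄) = max_{𝒫_w} f`.  Let
`τ : ℝ^d → ℝ^{d×d}` be `C¹` such that `τ(x)^⊤∇φ(x) = 0` whenever `x ∈ E` and
`φ ∈ C_c^∞(ℝ^d)` attains its maximum over `E` at `x`.  If `A_τ` maps `C_w^∞` into
`L¹(μ̄)` and `ℵ_τ` maps `C_w^∞ ⊗ C_w^∞` into `L¹(μ̄ ⊗ μ̄)`, then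
`⟨A_τ(∂f(μ̄)), μ̄⟩ + ⟨ℵ_τ(∂²f(μ̄)), μ̄²⟩ ≤ 0`. -/
theorem stmt_15 {d : ℕ} (w : EuclideanSpace ℝ (Fin d) → ℝ)
    (hw_smooth : ContDiff ℝ (⊤ : ℕ∞) w) (hw_one : ∀ x, 1 ≤ w x)
    (hw_infty : Tendsto w (cocompact (EuclideanSpace ℝ (Fin d))) atTop)
    (E : Set (EuclideanSpace ℝ (Fin d))) (hE_closed : IsClosed E) (hE_noncompact : ¬ IsCompact E)
    (Pw : Set (Measure (EuclideanSpace ℝ (Fin d))))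
    (hPw : Pw = {μ | IsProbabilityMeasure μ ∧ Integrable w μ ∧ μ Eᶜ = 0})
    (f : Measure (EuclideanSpace ℝ (Fin d)) → ℝ)
    (hf : f ∈ NonUnitalAlgebra.adjoin ℝ (DwGen w))
    (μbar : Measure (EuclideanSpace ℝ (Fin d))) (hμbar : μbar ∈ Pw)
    (hmax : ∀ μ ∈ Pw, f μ ≤ f μbar)
    (τ : EuclideanSpace ℝ (Fin d) → Fin d → Fin d → ℝ)
    (hτ_C1 : ∀ i j, ContDiff ℝ 1 (fun x => τ x i j))
    -- `τ` can be chosen as diffusion matrix for an `E`-valued diffusion, i.e. (2.1):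
    (hτ_inv : ∀ x ∈ E, ∀ φ : EuclideanSpace ℝ (Fin d) → ℝ,
      ContDiff ℝ (⊤ : ℕ∞) φ → HasCompactSupport φ → (∀ y ∈ E, φ y ≤ φ x) →
      ∀ j, (∑ i, τ x i j * gradient φ x i) = 0)
    -- `A_τ` maps `C_w^∞` into `L¹(ℝ^d, μ̄)`:
    (hA_int : ∀ φ ∈ CwInf w, Integrable (Atau τ φ) μbar)
    -- `ℵ_τ` maps `C_w^∞ ⊗ C_w^∞` into `L¹(ℝ^d × ℝ^d, μ̄ ⊗ μ̄)`:
    (hAleph_int : ∀ ψ : EuclideanSpace ℝ (Fin d) × EuclideanSpace ℝ (Fin d) → ℝ,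
      ψ ∈ Submodule.span ℝ {g | ∃ φ₁ ∈ CwInf w, ∃ φ₂ ∈ CwInf w,
        g = fun p : EuclideanSpace ℝ (Fin d) × EuclideanSpace ℝ (Fin d) => φ₁ p.1 * φ₂ p.2} →
      Integrable (fun p => alephTau τ (fun x y => ψ (x, y)) p.1 p.2) (μbar.prod μbar)) :
    (∫ x, Atau τ (fun y => mderiv f μbar y) x ∂μbar) +
      (∫ p, alephTau τ (fun x y => mderiv2 f μbar x y) p.1 p.2 ∂(μbar.prod μbar)) ≤ 0 := by
  
  subst hPw
  obtain ⟨hprob, hwi, hμE⟩ := hμbar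
  obtain ⟨W, _, _, _, a, ψ, F, hψ, hψc, hF, hfF⟩ := rep_of_mem hf
  set Φ : EuclideanSpace ℝ (Fin d) → W := fun x => w x • a + ψ x with hΦdef
  have hΦ : ContDiff ℝ (⊤ : ℕ∞) Φ := (hw_smooth.smul contDiff_const).add hψ
  have hΦi : ∀ μ : Measure (EuclideanSpace ℝ (Fin d)), IsFiniteMeasure μ → Integrable w μ →
      Integrable Φ μ := fun μ _ h => integrable_rep hψ hψc h
  have hF2 : ContDiff ℝ 1 (fderiv ℝ F) := hF.fderiv_right (m := 1) two_le_top
  set m := ∫ x, Φ x ∂μbar with hm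
  set l : W →L[ℝ] ℝ := fderiv ℝ F m with hl
  set B : W →L[ℝ] W →L[ℝ] ℝ := fderiv ℝ (fderiv ℝ F) m with hB
  have hd1 : ∀ ν : Measure (EuclideanSpace ℝ (Fin d)), IsFiniteMeasure ν → Integrable w ν →
      ∀ y, mderiv f ν y = fderiv ℝ F (∫ x, Φ x ∂ν) (Φ y) := fun ν _ hν y =>
    mderiv_rep hΦi hfF (hF.differentiable (by simp)) ν hν y
  have g1 : (fun y => mderiv f μbar y) = fun y => l (Φ y) :=
    funext fun y => hd1 μbar inferInstance hwi y
  have g2 : (fun x y => mderiv2 f μbar x y) = fun x y => B (Φ x) (Φ y) := by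
    funext x y
    unfold mderiv2
    have hdf : Differentiable ℝ (fderiv ℝ F) := hF2.differentiable one_ne_zero
    rw [mderiv_rep (G := fun z => fderiv ℝ F z (Φ y)) hΦi
      (fun ν h1 h2 => hd1 ν h1 h2 y)
      (fun z => (hdf z).clm_apply (differentiableAt_const _)) μbar hwi x]
    rw [fderiv_clm_apply (hdf _) (differentiableAt_const _)]
    simp [hB, hm]
  rw [g1, g2]
  let T : Fin d → EuclideanSpace ℝ (Fin d) → EuclideanSpace ℝ (Fin d) :=
    fun j x => WithLp.toLp 2 (fun i => τ x i j)
  have hT : ∀ j, ContDiff ℝ 1 (T j) := fun j =>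
    (contDiff_euclidean).2 fun i => hτ_C1 i j
  have hinv : ∀ j, ∀ x ∈ E, ∀ y, Metric.infDist y E = dist y x →
      inner ℝ (y - x) (T j x) = 0 := fun j =>
    orth_of_test (T := T j) fun x hx φ h1 h2 h3 => by
      rw [← hτ_inv x hx φ h1 h2 h3 j, sum_gradient]
  have hΦd : ∀ x, DifferentiableAt ℝ Φ x := hΦ.differentiable (by simp)
  have hv1 : ∀ j, ContDiff ℝ 1 (fun x => fderiv ℝ Φ x (T j x)) := fun j =>
    (hΦ.fderiv_right (m := 1) two_le_top).clm_apply (hT j)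
  have eA : ∀ x, Atau τ (fun y => l (Φ y)) x =
      ∑ j, l (fderiv ℝ (fun y => fderiv ℝ Φ y (T j y)) x (T j x)) := by
    intro x
    unfold Atau
    refine Finset.sum_congr rfl fun j _ => ?_
    rw [sum_gradient]
    have e1 : (fun y => ∑ k, τ y k j * gradient (fun y => l (Φ y)) y k) =
        fun y => l (fderiv ℝ Φ y (T j y)) := by
      funext y
      rw [sum_gradient, fderiv_clm_comp' l (hΦd y)]
    rw [e1, fderiv_clm_comp' l ((hv1 j).differentiable one_ne_zero x)]
  have eB : ∀ x y, alephTau τ (fun x y => B (Φ x) (Φ y)) x y =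
      ∑ j, B (fderiv ℝ Φ x (T j x)) (fderiv ℝ Φ y (T j y)) := by
    intro x y
    unfold alephTau
    refine Finset.sum_congr rfl fun j _ => ?_
    have e1 : ∀ k, (fun x' => gradient (fun y' => B (Φ x') (Φ y')) y k) =
        fun x' => B.flip (fderiv ℝ Φ y (EuclideanSpace.single k 1)) (Φ x') := by
      intro k
      funext x'
      rw [gradient_apply, fderiv_clm_comp' (B (Φ x')) (hΦd y)]
      rfl
    have e2 : ∀ k i, gradient (fun x' => gradient (fun y' => B (Φ x') (Φ y')) y k) x i =
        B (fderiv ℝ Φ x (EuclideanSpace.single i 1))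
          (fderiv ℝ Φ y (EuclideanSpace.single k 1)) := by
      intro k i
      rw [e1, gradient_apply, fderiv_clm_comp' (B.flip _) (hΦd x)]
      rfl
    have e3 : ∀ z, T j z = ∑ i, τ z i j • EuclideanSpace.single i (1 : ℝ) := by
      intro z
      ext i
      simp [T, Pi.single_apply]
    simp only [e2]
    rw [e3 x, e3 y]
    simp only [map_sum, map_smul, sum_apply, smul_apply, smul_eq_mul,
      Finset.mul_sum]
    rw [Finset.sum_comm]
    refine Finset.sum_congr rfl fun k _ => Finset.sum_congr rfl fun i _ => ?_
    ring
  have hcw : ∀ l' : W →L[ℝ] ℝ, (fun x => l' (Φ x)) ∈ CwInf w := fun l' =>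
    ⟨l' a, fun x => l' (ψ x), l'.contDiff.comp hψ, hψc.comp_left (map_zero l'), by
      funext x
      simp [hΦdef, mul_comm]⟩
  have hi1 := hA_int _ (hcw l)
  have hi2 := hAleph_int (fun p => B (Φ p.1) (Φ p.2)) (by
    let b := Module.finBasis ℝ W
    let c : Fin (Module.finrank ℝ W) → (W →L[ℝ] ℝ) := fun i => LinearMap.toContinuousLinearMap (b.coord i)
    have : (fun p : EuclideanSpace ℝ (Fin d) × EuclideanSpace ℝ (Fin d) => B (Φ p.1) (Φ p.2)) =
        ∑ i, fun p => c i (Φ p.1) * B (b i) (Φ p.2) := by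
      funext p
      conv_lhs => rw [← b.sum_repr (Φ p.1)]
      rw [map_sum, sum_apply, Finset.sum_apply]
      refine Finset.sum_congr rfl fun i _ => ?_
      rw [map_smul, smul_apply, smul_eq_mul]
      rfl
    rw [this]
    exact Submodule.sum_mem _ fun i _ => Submodule.subset_span
      ⟨_, hcw (c i), _, hcw (B (b i)), rfl⟩)
  simp only [eB] at hi2 ⊢
  rw [funext eA] at hi1
  simp only [eA]
  exact core hE_closed hinv hT μbar hμE hw_smooth hwi hΦ (hΦi _ inferInstance hwi) hF
    (fun ν h1 h2 h3 => by
      rw [← hfF ν inferInstance h2, ← hfF μbar inferInstance hwi]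
      exact hmax ν ⟨h1, h2, h3⟩) l hl B hB hi1 hi2
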